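/- Let m ≥ 1 be an integer and let e := (0,…,0,1) ∈ ℝ^{m+1}. For every λ ∈ (1,∞), τ ∈ [1,λ], k ∈ ℤ, h ∈ ℝ^m and j ∈ ℤ^m, if Q := Q^+_{λ,τ,k,h,j} is the corresponding λ-adic cube of ℝ^{m+1}_+, then for all x, y ∈ Q one has |x + 2e| / |y + 2e| ≤ 1 + (λ − 1)·√(m+1). -/

import Mathlib

open MeasureTheory Metric Set
open scoped ENNReal Topology

noncomputable section

abbrev Euc (m : ℕ) : Type := EuclideanSpace ℝ (Fin m)

/-- Truncated mean oscillation `MO_{δ,p} u (x', r)` of a map `u : ℝ^m → N`: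
the double average over the ball of radius `r` centered at `x'` of
`(d(u y, u z) - δ)₊ ^ p`. -/
def MO {N : Type} [PseudoMetricSpace N] {m : ℕ} (p δ : ℝ) (u : Euc m → N)
    (x' : Euc m) (r : ℝ) : ℝ≥0∞ :=
  (volume (ball x' r))⁻¹ * (volume (ball x' r))⁻¹ *
    ∫⁻ y in ball x' r, ∫⁻ z in ball x' r,
      ENNReal.ofReal (max (dist (u y) (u z) - δ) 0 ^ p)

/-- Truncated Gagliardo energy `∬ (d(u y, u z) - δ)₊^p / |y-z|^{2m}`. -/
def truncGagliardo {N : Type} [PseudoMetricSpace N] {m : ℕ} (p δ : ℝ)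
    (u : Euc m → N) : ℝ≥0∞ :=
  ∫⁻ y, ∫⁻ z, ENNReal.ofReal (max (dist (u y) (u z) - δ) 0 ^ p) /
    ENNReal.ofReal (dist y z ^ (2 * m))

/-- The cube `r·([0,1]^m + c)` of edge length `r` in `ℝ^m`. -/
def cube (m : ℕ) (r : ℝ) (c : Fin m → ℝ) : Set (Euc m) :=
  {x | ∀ i, x i ∈ Icc (r * c i) (r * (c i + 1))}


/-- The λ-adic cube `Q⁺_{λ,τ,k,h,j}` of the half-space `ℝ^m × (0,∞)`, with base
`τλ^{-k}([0,1]^m + c)` (where `c = j + h`) and height interval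
`[τλ^{-k}/(λ-1), τλ^{-(k-1)}/(λ-1)]`. -/
def cubeQ (m : ℕ) (lam τ : ℝ) (k : ℤ) (c : Fin m → ℝ) : Set (Euc m × ℝ) :=
  cube m (τ * lam ^ (-k)) c ×ˢ
    Icc (τ * lam ^ (-k) / (lam - 1)) (τ * lam ^ (-(k - 1)) / (lam - 1))

/-- The Euclidean norm of `x + 2e` for `x = (x', x_{m+1}) ∈ ℝ^m × ℝ`, where
`e = (0, …, 0, 1)`. -/
def normPlusTwoE {m : ℕ} (x : Euc m × ℝ) : ℝ :=
  Real.sqrt (‖x.1‖ ^ 2 + (x.2 + 2) ^ 2)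

/-- Triangle inequality for `x ↦ |x + 2e|`. -/
lemma normPlusTwoE_le_add {m : ℕ} (x y : Euc m × ℝ) :
    normPlusTwoE x ≤ normPlusTwoE y + Real.sqrt (‖x.1 - y.1‖ ^ 2 + (x.2 - y.2) ^ 2) := by
  have H := norm_add_le (WithLp.toLp 2 (y.1, y.2 + 2) : WithLp 2 (Euc m × ℝ))
    (WithLp.toLp 2 (x.1 - y.1, x.2 - y.2))
  have e : y.2 + 2 + (x.2 - y.2) = x.2 + 2 := by ring
  rw [← WithLp.toLp_add] at H
  simpa [WithLp.prod_norm_eq_of_L2, normPlusTwoE, e] using H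

lemma le_normPlusTwoE {m : ℕ} (y : Euc m × ℝ) : y.2 + 2 ≤ normPlusTwoE y :=
  Real.le_sqrt_of_sq_le (le_add_of_nonneg_left (sq_nonneg _))

lemma norm_sub_sq_le_of_mem_cube {m : ℕ} {r : ℝ} {c : Fin m → ℝ} {x y : Euc m}
    (hx : x ∈ cube m r c) (hy : y ∈ cube m r c) : ‖x - y‖ ^ 2 ≤ m * r ^ 2 := by
  rw [EuclideanSpace.norm_sq_eq]
  calc ∑ i, ‖(x - y) i‖ ^ 2 ≤ ∑ _i : Fin m, r ^ 2 := by
        refine Finset.sum_le_sum fun i _ => ?_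
        have h₁ := hx i
        have h₂ := hy i
        rw [mem_Icc] at h₁ h₂
        rw [Real.norm_eq_abs, sq_abs, PiLp.sub_apply]
        exact sq_le_sq' (by linarith) (by linarith)
    _ = m * r ^ 2 := by simp

/-- Geometric comparison ('eq_ugh7'): for all `x, y` in a λ-adic cube,
`|x + 2e| / |y + 2e| ≤ 1 + (λ - 1)√(m+1)`. -/
theorem conformal_factor_comparison (m : ℕ) (hm : 1 ≤ m)
    (lam : ℝ) (hlam : 1 < lam) (τ : ℝ) (hτ : τ ∈ Icc 1 lam)
    (k : ℤ) (h : Fin m → ℝ) (j : Fin m → ℤ) :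
    ∀ x ∈ cubeQ m lam τ k (fun i => (j i : ℝ) + h i),
    ∀ y ∈ cubeQ m lam τ k (fun i => (j i : ℝ) + h i),
      normPlusTwoE x / normPlusTwoE y ≤ 1 + (lam - 1) * Real.sqrt (m + 1) := by
  rintro x ⟨hx, hx'⟩ y ⟨hy, hy'⟩
  have hlam₁ : 0 < lam - 1 := sub_pos.2 hlam
  have hr : 0 < τ * lam ^ (-k) :=
    mul_pos (zero_lt_one.trans_le hτ.1) (zpow_pos (zero_lt_one.trans hlam) _)
  have htop : τ * lam ^ (-(k - 1)) / (lam - 1) =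
      τ * lam ^ (-k) / (lam - 1) + τ * lam ^ (-k) := by
    rw [neg_sub, sub_eq_neg_add, zpow_add_one₀ (zero_lt_one.trans hlam).ne']
    field_simp
    ring
  rw [htop] at hx' hy'
  rw [mem_Icc] at hx' hy'
  generalize τ * lam ^ (-k) = r at *
  have hsq : (x.2 - y.2) ^ 2 ≤ r ^ 2 := sq_le_sq' (by linarith) (by linarith)
  have hdist : Real.sqrt (‖x.1 - y.1‖ ^ 2 + (x.2 - y.2) ^ 2) ≤ r * Real.sqrt (m + 1) := by
    refine Real.sqrt_le_iff.2 ⟨by positivity, ?_⟩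
    rw [mul_pow, Real.sq_sqrt (by positivity)]
    linarith [norm_sub_sq_le_of_mem_cube hx hy]
  have hlow : r / (lam - 1) ≤ normPlusTwoE y := by
    linarith [le_normPlusTwoE y]
  have hpos : 0 < normPlusTwoE y := (div_pos hr hlam₁).trans_le hlow
  rw [div_le_iff₀' hlam₁] at hlow
  rw [div_le_iff₀ hpos]
  linarith [normPlusTwoE_le_add x y,
    mul_le_mul_of_nonneg_right hlow (Real.sqrt_nonneg ((m : ℝ) + 1))]
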